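/- Let p be a prime and let A be a p-power torsion abelian group. Then the following are equivalent: (i) there exist a natural number e and a finite abelian p-group F such that A is isomorphic (as an abelian group) to (ℚ_p/ℤ_p)^{⊕e} ⊕ F; (ii) both A[p] and A/pA are finite. -/

import Mathlib

/-- Multiplication by `m` as an additive monoid homomorphism. -/
def smulHom (m : ℕ) (A : Type*) [AddCommGroup A] : A →+ A :=
  AddMonoidHom.mk' (fun a => m • a) (fun a b => smul_add m a b)

/-- The `m`-torsion subgroup `A[m]` of `A`. -/
def torsSub (m : ℕ) (A : Type*) [AddCommGroup A] : AddSubgroup A :=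
  (smulHom m A).ker

/-- The subgroup `m·A` of `A`. -/
def mulRange (m : ℕ) (A : Type*) [AddCommGroup A] : AddSubgroup A :=
  (smulHom m A).range

lemma mem_torsSub {m : ℕ} {A : Type*} [AddCommGroup A] {a : A} :
    a ∈ torsSub m A ↔ m • a = 0 := Iff.rfl

/-- The `p`-adic Tate module of `A`, realized as the group of sequences
`(a_n)` (indexed so that `a n` corresponds to `a_{n+1}`) with `p^(n+1) • a n = 0`
and `p • a (n+1) = a n`. -/
def Tate (p : ℕ) (A : Type*) [AddCommGroup A] : AddSubgroup (ℕ → A) where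
  carrier := {a | (∀ n, p ^ (n + 1) • a n = 0) ∧ ∀ n, p • a (n + 1) = a n}
  zero_mem' := ⟨fun n => smul_zero _, fun n => smul_zero _⟩
  add_mem' := by
    rintro a b ⟨ha1, ha2⟩ ⟨hb1, hb2⟩
    exact ⟨fun n => by simp [smul_add, ha1 n, hb1 n],
           fun n => by simp [smul_add, ha2 n, hb2 n]⟩
  neg_mem' := by
    rintro a ⟨ha1, ha2⟩
    exact ⟨fun n => by simp [smul_neg, ha1 n], fun n => by simp [smul_neg, ha2 n]⟩

lemma mem_Tate {p : ℕ} {A : Type*} [AddCommGroup A] {a : ℕ → A} :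
    a ∈ Tate p A ↔ (∀ n, p ^ (n + 1) • a n = 0) ∧ ∀ n, p • a (n + 1) = a n := Iff.rfl

/-- The Prüfer group `ℚ_p/ℤ_p`. -/
abbrev QmodZ (p : ℕ) [Fact p.Prime] : Type :=
  ℚ_[p] ⧸ (PadicInt.Coe.ringHom (p := p)).toAddMonoidHom.range

/-- Transition map `A/p^(n+2)A → A/p^(n+1)A` in the `p`-adic completion. -/
def projHom (p : ℕ) (A : Type*) [AddCommGroup A] (n : ℕ) :
    (A ⧸ mulRange (p ^ (n + 2)) A) →+ (A ⧸ mulRange (p ^ (n + 1)) A) :=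
  QuotientAddGroup.map _ _ (AddMonoidHom.id A) (by
    rintro x ⟨a, rfl⟩
    exact ⟨p • a, by
      show (p ^ (n + 1)) • (p • a) = (AddMonoidHom.id A) ((p ^ (n + 2)) • a)
      simp [← mul_smul, ← pow_succ]⟩)

/-- The `p`-adic completion `lim_n A/p^n A` of `A`, realized as the group of
compatible sequences (`c n` corresponds to the component in `A/p^(n+1)A`). -/
def Completion (p : ℕ) (A : Type*) [AddCommGroup A] :
    AddSubgroup (∀ n : ℕ, A ⧸ mulRange (p ^ (n + 1)) A) where
  carrier := {c | ∀ n, projHom p A n (c (n + 1)) = c n}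
  zero_mem' := fun n => map_zero _
  add_mem' := by
    intro a b ha hb n
    simp only [Pi.add_apply, map_add, ha n, hb n]
  neg_mem' := by
    intro a ha n
    simp only [Pi.neg_apply, map_neg, ha n]

namespace AddMonoidHom

variable {p : ℕ} {A B : Type*} [AddCommGroup A] [AddCommGroup B]

/-- A homomorphism out of a `p`-power torsion group is injective if it is so on `A[p]`. -/
lemma injective_of_injective_on_torsion (hA : ∀ a : A, ∃ n : ℕ, p ^ n • a = 0) (f : A →+ B)
    (hf : ∀ a, p • a = 0 → f a = 0 → a = 0) : Function.Injective f := by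
  have key : ∀ n : ℕ, ∀ a : A, p ^ n • a = 0 → f a = 0 → a = 0 := by
    intro n
    induction n with
    | zero => intro a ha _; simpa using ha
    | succ n ih =>
      intro a ha h
      refine ih a (hf _ ?_ ?_) h
      · rw [← mul_smul, ← pow_succ', ha]
      · rw [map_nsmul, h, smul_zero]
  refine (injective_iff_map_eq_zero f).2 fun a h => ?_
  obtain ⟨n, hn⟩ := hA a
  exact key n a hn h

/-- If the `p`-divisible subgroup `D` maps onto `B[p]` and `B` is `p`-power torsion, then `D` maps
onto `B`. -/
lemma exists_mem_map_eq_of_divisible (hB : ∀ b : B, ∃ n : ℕ, p ^ n • b = 0) (f : A →+ B)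
    (D : AddSubgroup A) (hD : ∀ x ∈ D, ∃ y ∈ D, p • y = x)
    (hf : ∀ b : B, p • b = 0 → ∃ x ∈ D, f x = b) (b : B) : ∃ x ∈ D, f x = b := by
  have hD' : ∀ n : ℕ, ∀ x ∈ D, ∃ y ∈ D, p ^ n • y = x := by
    intro n
    induction n with
    | zero => exact fun x hx => ⟨x, hx, by simp⟩
    | succ n ih =>
      intro x hx
      obtain ⟨y, hy, rfl⟩ := ih x hx
      obtain ⟨z, hz, rfl⟩ := hD y hy
      exact ⟨z, hz, by rw [pow_succ, mul_smul]⟩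
  have key : ∀ n : ℕ, ∀ b : B, p ^ n • b = 0 → ∃ x ∈ D, f x = b := by
    intro n
    induction n with
    | zero => exact fun b hb => ⟨0, D.zero_mem, by simpa using hb.symm⟩
    | succ n ih =>
      intro b hb
      obtain ⟨x, hx, hxb⟩ := hf (p ^ n • b) (by rw [← mul_smul, ← pow_succ', hb])
      obtain ⟨y, hy, rfl⟩ := hD' n x hx
      obtain ⟨z, hz, hzb⟩ := ih (b - f y) (by rw [smul_sub, ← hxb, map_nsmul, sub_self])
      exact ⟨z + y, D.add_mem hz hy, by rw [map_add, hzb, sub_add_cancel]⟩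
  obtain ⟨n, hn⟩ := hB b
  exact key n b hn

end AddMonoidHom

section mulRange

variable {p : ℕ} {A : Type*} [AddCommGroup A]

lemma mulRange_pow_antitone (p : ℕ) (A : Type*) [AddCommGroup A] :
    Antitone fun n : ℕ => mulRange (p ^ n) A := by
  rintro m n hmn _ ⟨b, rfl⟩
  refine ⟨p ^ (n - m) • b, ?_⟩
  change p ^ m • p ^ (n - m) • b = p ^ n • b
  rw [← mul_smul, ← pow_add, Nat.add_sub_cancel' hmn]

/-- If `A/pA` is finite then so is `A/p^nA`. -/
lemma finite_quotient_mulRange_pow (h : Finite (A ⧸ mulRange p A)) (n : ℕ) :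
    Finite (A ⧸ mulRange (p ^ n) A) := by
  induction n with
  | zero =>
    have : Subsingleton (A ⧸ mulRange (p ^ 0) A) := by
      rw [QuotientAddGroup.subsingleton_iff, eq_top_iff]
      exact fun a _ => ⟨a, by simp [smulHom]⟩
    infer_instance
  | succ n ih =>
    refine Finite.of_surjective
      (fun u : (A ⧸ mulRange p A) × (A ⧸ mulRange (p ^ n) A) =>
        (QuotientAddGroup.mk (u.1.out + p • u.2.out) : A ⧸ mulRange (p ^ (n + 1)) A)) fun a => ?_
    induction a using QuotientAddGroup.induction_on with
    | H a =>
      obtain ⟨b, hb⟩ := QuotientAddGroup.eq.1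
        (QuotientAddGroup.out_eq' (QuotientAddGroup.mk a : A ⧸ mulRange p A))
      obtain ⟨c, hc⟩ := QuotientAddGroup.eq.1
        (QuotientAddGroup.out_eq' (QuotientAddGroup.mk b : A ⧸ mulRange (p ^ n) A))
      refine ⟨(QuotientAddGroup.mk a, QuotientAddGroup.mk b), QuotientAddGroup.eq.2 ⟨c, ?_⟩⟩
      change p • b = _ at hb
      change p ^ n • c = _ at hc
      change p ^ (n + 1) • c = _
      rw [pow_succ', mul_smul, hc, smul_add, hb]
      simp only [smul_neg]
      abel

/-- If `A` is `p`-power torsion with `A[p]` finite, the chain `p^nA` becomes stationary. -/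
lemma exists_mulRange_pow_divisible (hA : ∀ a : A, ∃ n : ℕ, p ^ n • a = 0)
    (h : Finite (torsSub p A)) :
    ∃ N : ℕ, ∀ x ∈ mulRange (p ^ N) A, ∃ y ∈ mulRange (p ^ N) A, p • y = x := by
  have hfin : (torsSub p A : Set A).Finite := h
  obtain ⟨N, hN⟩ : ∃ N : ℕ, ∀ x ∈ torsSub p A, x ∈ mulRange (p ^ N) A →
      ∀ n, x ∈ mulRange (p ^ n) A := by
    have hex : ∀ x : A, ∃ m : ℕ, x ∈ mulRange (p ^ m) A → ∀ n, x ∈ mulRange (p ^ n) A := by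
      intro x
      by_cases hx : ∀ n, x ∈ mulRange (p ^ n) A
      · exact ⟨0, fun _ => hx⟩
      · obtain ⟨m, hm⟩ := not_forall.1 hx
        exact ⟨m, fun h => absurd h hm⟩
    choose m hm using hex
    refine ⟨hfin.toFinset.sup m, fun x hx hxN => hm x ?_⟩
    exact mulRange_pow_antitone p A (Finset.le_sup (hfin.mem_toFinset.2 hx)) hxN
  have key : ∀ M, N ≤ M → ∀ k : ℕ, ∀ x ∈ mulRange (p ^ N) A, p ^ k • x = 0 →
      x ∈ mulRange (p ^ M) A := by
    intro M hM k
    induction k with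
    | zero =>
      intro x _ hx
      rw [pow_zero, one_smul] at hx
      exact hx ▸ zero_mem _
    | succ k ih =>
      intro x hx hxk
      obtain ⟨y, hy⟩ := hN (p ^ k • x) (by rw [mem_torsSub, ← mul_smul, ← pow_succ', hxk])
        (AddSubgroup.nsmul_mem _ hx _) (k + M)
      change p ^ (k + M) • y = _ at hy
      have hz : p ^ M • y ∈ mulRange (p ^ M) A := ⟨y, rfl⟩
      have := ih (x - p ^ M • y) (sub_mem hx (mulRange_pow_antitone p A hM hz))
        (by rw [smul_sub, ← hy, pow_add, mul_smul, sub_self])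
      simpa using add_mem this hz
  refine ⟨N, fun x hx => ?_⟩
  obtain ⟨k, hk⟩ := hA x
  obtain ⟨y, hy⟩ := key (N + 1) N.le_succ k x hx hk
  refine ⟨p ^ N • y, ⟨y, rfl⟩, ?_⟩
  rw [← hy, ← mul_smul, ← pow_succ']
  rfl

end mulRange

namespace QmodZ

variable (p : ℕ) [Fact p.Prime]

lemma mk_eq_zero_iff {x : ℚ_[p]} : (QuotientAddGroup.mk x : QmodZ p) = 0 ↔ ‖x‖ ≤ 1 := by
  rw [QuotientAddGroup.eq_zero_iff]
  exact ⟨by rintro ⟨y, rfl⟩; exact y.2, fun h => ⟨⟨x, h⟩, rfl⟩⟩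

lemma exists_pow_smul_eq_zero (x : QmodZ p) : ∃ n : ℕ, p ^ n • x = 0 := by
  induction x using QuotientAddGroup.induction_on with
  | H x =>
    obtain ⟨n, hn⟩ := exists_pow_lt_of_lt_one (show (0 : ℝ) < 1 / (‖x‖ + 1) by positivity)
      (Padic.norm_p_lt_one (p := p))
    refine ⟨n, ?_⟩
    rw [← QuotientAddGroup.mk_nsmul, mk_eq_zero_iff, nsmul_eq_mul, Nat.cast_pow, norm_mul,
      norm_pow]
    rw [lt_div_iff₀ (by positivity)] at hn
    nlinarith [norm_nonneg x, pow_nonneg (norm_nonneg (p : ℚ_[p])) n]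

lemma exists_smul_eq (x : QmodZ p) : ∃ y : QmodZ p, p • y = x := by
  induction x using QuotientAddGroup.induction_on with
  | H x =>
    refine ⟨QuotientAddGroup.mk ((p : ℚ_[p])⁻¹ * x), ?_⟩
    have hp : (p : ℚ_[p]) ≠ 0 := Nat.cast_ne_zero.2 (Fact.out : p.Prime).ne_zero
    rw [← QuotientAddGroup.mk_nsmul, nsmul_eq_mul, mul_inv_cancel_left₀ hp]

lemma baer : Module.Baer ℤ (QmodZ p) :=
  let _ : DivisibleBy ℚ_[p] ℕ := AddGroup.divisibleByNatOfDivisibleByInt ℚ_[p]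
  let _ : DivisibleBy (QmodZ p) ℤ := AddGroup.divisibleByIntOfDivisibleByNat (QmodZ p)
  Module.Baer.of_divisible _

/-- Homomorphisms to `(ℚ_p/ℤ_p)^e` extend from subgroups. -/
lemma exists_extension_pi {A : Type*} [AddCommGroup A] (V : AddSubgroup A) {e : ℕ}
    (g : V →+ (Fin e → QmodZ p)) : ∃ f : A →+ (Fin e → QmodZ p), ∀ v : V, f v = g v := by
  choose f hf using fun i => (baer p).extension_property_addMonoidHom V.subtype
    V.subtype_injective ((Pi.evalAddMonoidHom _ i).comp g)
  exact ⟨AddMonoidHom.pi f, fun v => funext fun i => DFunLike.congr_fun (hf i) v⟩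

/-- The embedding `ℤ/p → ℚ_p/ℤ_p` sending `1` to `1/p`. -/
noncomputable def ofZMod : ZMod p →+ QmodZ p :=
  ZMod.lift p ⟨zmultiplesHom _ (QuotientAddGroup.mk (p : ℚ_[p])⁻¹), by
    have hp : (p : ℚ_[p]) ≠ 0 := Nat.cast_ne_zero.2 (Fact.out : p.Prime).ne_zero
    rw [zmultiplesHom_apply, natCast_zsmul, ← QuotientAddGroup.mk_nsmul, nsmul_eq_mul,
      mul_inv_cancel₀ hp, mk_eq_zero_iff, norm_one]⟩

lemma ofZMod_intCast (k : ℤ) :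
    ofZMod p k = (QuotientAddGroup.mk (k * (p : ℚ_[p])⁻¹) : QmodZ p) := by
  rw [ofZMod, ZMod.lift_coe]
  change k • (QuotientAddGroup.mk (p : ℚ_[p])⁻¹ : QmodZ p) = _
  rw [← QuotientAddGroup.mk_zsmul, zsmul_eq_mul]

lemma ofZMod_injective : Function.Injective (ofZMod p) := by
  refine (injective_iff_map_eq_zero _).2 fun x hx => ?_
  obtain ⟨k, rfl⟩ := ZMod.intCast_surjective x
  rw [ofZMod_intCast, mk_eq_zero_iff, norm_mul, norm_inv, Padic.norm_p, inv_inv] at hx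
  rw [ZMod.intCast_zmod_eq_zero_iff_dvd, ← Padic.norm_intCast_lt_one_iff]
  have hp : (1 : ℝ) < p := by exact_mod_cast (Fact.out : p.Prime).one_lt
  nlinarith [norm_nonneg (k : ℚ_[p])]

lemma exists_ofZMod_eq {x : QmodZ p} (hx : p • x = 0) : ∃ k, ofZMod p k = x := by
  induction x using QuotientAddGroup.induction_on with
  | H x =>
    have hp : (p : ℚ_[p]) ≠ 0 := Nat.cast_ne_zero.2 (Fact.out : p.Prime).ne_zero
    rw [← QuotientAddGroup.mk_nsmul, mk_eq_zero_iff, nsmul_eq_mul] at hx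
    let z : ℤ_[p] := ⟨p * x, hx⟩
    obtain ⟨y, hy⟩ : (p : ℤ_[p]) ∣ z - z.zmodRepr :=
      (PadicInt.norm_lt_one_iff_dvd _).1 z.norm_sub_zmodRepr_lt_one
    have hy' : (p : ℚ_[p]) * x - z.zmodRepr = p * y := by
      have h := congrArg (PadicInt.Coe.ringHom (p := p)) hy
      rwa [map_sub, map_mul, map_natCast, map_natCast] at h
    refine ⟨((z.zmodRepr : ℤ) : ZMod p), ?_⟩
    rw [ofZMod_intCast, QuotientAddGroup.eq]
    refine ⟨y, mul_left_cancel₀ hp ?_⟩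
    change (p : ℚ_[p]) * y = _
    rw [← hy']
    field_simp
    push_cast
    ring

lemma finite_setOf_smul_eq_zero : {x : QmodZ p | p • x = 0}.Finite :=
  (Set.finite_range (ofZMod p)).subset fun _ hx => exists_ofZMod_eq p hx

/-- A finite `𝔽_p`-vector space is isomorphic to the `p`-torsion of some `(ℚ_p/ℤ_p)^e`. -/
lemma exists_injective_of_zmodModule (V : Type*) [AddCommGroup V] [Finite V] [Module (ZMod p) V] :
    ∃ (e : ℕ) (g : V →+ (Fin e → QmodZ p)), Function.Injective g ∧
      ∀ y, p • y = 0 → ∃ v, g v = y := by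
  let b := Module.finBasis (ZMod p) V
  refine ⟨_, ((ofZMod p).compLeft _).comp b.equivFun.toAddEquiv.toAddMonoidHom, ?_, ?_⟩
  · exact ((ofZMod_injective p).comp_left).comp b.equivFun.injective
  · intro y hy
    choose k hk using fun i => exists_ofZMod_eq p (congrFun hy i)
    refine ⟨b.equivFun.symm k, funext fun i => ?_⟩
    change ofZMod p (b.equivFun (b.equivFun.symm k) i) = y i
    rw [LinearEquiv.apply_symm_apply, hk]

end QmodZ

/-- A `p`-power torsion abelian group `A` is isomorphic to
`(ℚ_p/ℤ_p)^{⊕e} ⊕ F` for some `e : ℕ` and finite abelian `p`-group `F` if and only if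
both `A[p]` and `A/pA` are finite. -/
theorem statement0 (p : ℕ) [Fact p.Prime] (A : Type) [AddCommGroup A]
    (hA : ∀ a : A, ∃ n : ℕ, p ^ n • a = 0) :
    (∃ (e : ℕ) (F : Type) (_ : AddCommGroup F) (_ : Finite F),
        (∀ x : F, ∃ n : ℕ, p ^ n • x = 0) ∧
          Nonempty (A ≃+ ((Fin e → QmodZ p) × F))) ↔
      (Finite (torsSub p A) ∧ Finite (A ⧸ mulRange p A)) := by
  constructor
  · rintro ⟨e, F, _, _, -, ⟨φ⟩⟩
    refine ⟨?_, ?_⟩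
    · have hT : {y : (Fin e → QmodZ p) × F | p • y = 0}.Finite := by
        refine ((Set.Finite.pi' fun _ => QmodZ.finite_setOf_smul_eq_zero p).prod
          (Set.finite_univ (α := F))).subset fun y hy => ⟨fun i => ?_, trivial⟩
        exact congrFun (congrArg Prod.fst hy) i
      refine Set.Finite.to_subtype ((hT.preimage φ.injective.injOn).subset fun a ha => ?_)
      change p • φ a = 0
      rw [← map_nsmul, mem_torsSub.1 ha, map_zero]
    · refine Finite.of_surjective
        (fun y : F => (QuotientAddGroup.mk (φ.symm (0, y)) : A ⧸ mulRange p A)) fun a => ?_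
      induction a using QuotientAddGroup.induction_on with
      | H a =>
        choose q hq using fun i => QmodZ.exists_smul_eq p ((φ a).1 i)
        refine ⟨(φ a).2, QuotientAddGroup.eq.2 ⟨φ.symm (q, 0), φ.injective ?_⟩⟩
        change φ (p • φ.symm (q, 0)) = _
        rw [map_nsmul, map_add, map_neg, AddEquiv.apply_symm_apply, AddEquiv.apply_symm_apply]
        ext i
        · simpa using hq i
        · simp
  · rintro ⟨hT, hQ⟩
    obtain ⟨N, hD⟩ := exists_mulRange_pow_divisible hA hT
    set D := mulRange (p ^ N) A
    have : Finite (D ⊓ torsSub p A : AddSubgroup A) :=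
      Set.Finite.to_subtype (Set.Finite.subset (s := (torsSub p A : Set A)) hT fun _ hx => hx.2)
    let _ : Module (ZMod p) (D ⊓ torsSub p A : AddSubgroup A) :=
      AddCommGroup.zmodModule fun v => Subtype.ext v.2.2
    obtain ⟨e, g, hg, hg'⟩ :=
      QmodZ.exists_injective_of_zmodModule p (D ⊓ torsSub p A : AddSubgroup A)
    obtain ⟨f, hf⟩ := QmodZ.exists_extension_pi p _ g
    have htors : ∀ y : Fin e → QmodZ p, ∃ n : ℕ, p ^ n • y = 0 := by
      intro y
      choose n hn using fun i => QmodZ.exists_pow_smul_eq_zero p (y i)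
      refine ⟨∑ i, n i, funext fun i => ?_⟩
      obtain ⟨k, hk⟩ := pow_dvd_pow p (Finset.single_le_sum (fun _ _ => Nat.zero_le _)
        (Finset.mem_univ i) : n i ≤ ∑ i, n i)
      rw [Pi.smul_apply, hk, mul_comm, mul_smul, hn, smul_zero, Pi.zero_apply]
    have hfD := f.exists_mem_map_eq_of_divisible htors D hD fun y hy => by
      obtain ⟨v, hv⟩ := hg' y hy
      exact ⟨v, v.2.1, by rw [hf, hv]⟩
    refine ⟨e, A ⧸ D, inferInstance, finite_quotient_mulRange_pow hQ N, fun x => ?_,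
      ⟨AddEquiv.ofBijective (f.prod (QuotientAddGroup.mk' D)) ⟨?_, ?_⟩⟩⟩
    · induction x using QuotientAddGroup.induction_on with
      | H a =>
        obtain ⟨n, hn⟩ := hA a
        exact ⟨n, by rw [← QuotientAddGroup.mk_nsmul, hn, QuotientAddGroup.mk_zero]⟩
    · refine AddMonoidHom.injective_of_injective_on_torsion hA _ fun a ha h => ?_
      obtain ⟨h1, h2⟩ := Prod.mk.inj h
      have haD : a ∈ D := (QuotientAddGroup.eq_zero_iff a).1 h2
      have := (injective_iff_map_eq_zero g).1 hg ⟨a, haD, ha⟩ (by rw [← hf]; exact h1)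
      exact congrArg Subtype.val this
    · rintro ⟨q, x⟩
      induction x using QuotientAddGroup.induction_on with
      | H a =>
        obtain ⟨d, hd, hdq⟩ := hfD (q - f a)
        refine ⟨a + d, Prod.ext ?_ ?_⟩
        · change f (a + d) = q
          rw [map_add, hdq, add_sub_cancel]
        · exact QuotientAddGroup.mk_add_of_mem a hd
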